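/- arXiv:math/0606233 — 3 statements merged into one kernel-verified Lean document; each statement's English description precedes it below -/
import Mathlib

section
/- Let B be a commutative ℂ-algebra and n a positive integer. Then the algebra of symmetric tensors S^nB = (B^{⊗n})^{S_n} is generated as a ℂ-algebra by the elements b⊗1⊗...⊗1 + 1⊗b⊗...⊗1 + ... + 1⊗1⊗...⊗b for b ∈ B. -/
open PiTensorProduct
open scoped TensorProduct

section aux
open Classical

lemma weyl_aux {B A : Type*} [CommRing B] [CommRing A] [Algebra ℂ A] (n : ℕ)
    (e : Fin n → B →* A) (S : Subalgebra ℂ A) (hS : ∀ b, ∑ i, e i b ∈ S) :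
    ∀ (k : ℕ) (c : Fin k → B),
      (∑ f : Fin k → Fin n, if Function.Injective f then ∏ j, e (f j) (c j) else 0) ∈ S := by
  intro k
  induction k with
  | zero =>
    intro c
    refine S.sum_mem fun f _ => ?_
    split_ifs
    · simp
    · exact S.zero_mem
  | succ k ih =>
    intro c
    have key : (∑ f : Fin (k+1) → Fin n, if Function.Injective f then ∏ j, e (f j) (c j) else 0)
        = (∑ i, e i (c 0)) * (∑ f : Fin k → Fin n,
            if Function.Injective f then ∏ j, e (f j) (c j.succ) else 0)
          - ∑ l : Fin k, ∑ f : Fin k → Fin n, if Function.Injective f then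
              ∏ j, e (f j) (Function.update (fun j => c j.succ) l (c 0 * c l.succ) j) else 0 := by
      rw [← (Fin.consEquiv (fun _ : Fin (k+1) => Fin n)).sum_comp, Fintype.sum_prod_type,
        Finset.sum_comm, Finset.sum_comm (s := (Finset.univ : Finset (Fin k))), Finset.mul_sum,
        ← Finset.sum_sub_distrib]
      refine Finset.sum_congr rfl fun f _ => ?_
      have hinj : ∀ i : Fin n,
          Function.Injective (Fin.consEquiv (fun _ : Fin (k+1) => Fin n) (i, f)) ↔
            i ∉ Set.range f ∧ Function.Injective f := fun i => Fin.cons_injective_iff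
      by_cases hf : Function.Injective f
      · have h1 : ∀ l : Fin k,
            ∏ j, e (f j) (Function.update (fun j => c j.succ) l (c 0 * c l.succ) j)
              = e (f l) (c 0) * ∏ j, e (f j) (c j.succ) := by
          intro l
          rw [← Finset.mul_prod_erase _ _ (Finset.mem_univ l),
            ← Finset.mul_prod_erase (a := l) _ (fun j => e (f j) (c j.succ)) (Finset.mem_univ l)]
          rw [Function.update_self, map_mul, mul_assoc]
          congr 2
          refine Finset.prod_congr rfl fun j hj => ?_
          rw [Function.update_of_ne (Finset.ne_of_mem_erase hj)]
        simp only [hinj, Fin.consEquiv_apply, hf, and_true, if_true,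
          Fin.prod_univ_succ, Fin.cons_zero, Fin.cons_succ, h1]
        rw [← Finset.sum_mul, ← sub_mul]
        have h2 : ∑ l, e (f l) (c 0) = ∑ i, if i ∈ Set.range f then e i (c 0) else 0 := by
          rw [← Finset.sum_filter, ← Finset.sum_image (s := Finset.univ) (g := f)
            (f := fun i => e i (c 0)) hf.injOn]
          refine Finset.sum_congr ?_ fun _ _ => rfl
          ext i; simp
        rw [h2, ← Finset.sum_sub_distrib, Finset.sum_mul]
        refine Finset.sum_congr rfl fun i _ => ?_
        by_cases hi : i ∈ Set.range f <;> simp only [hi] <;> simp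
      · simp only [hinj, hf]; simp
    rw [key]
    exact S.sub_mem (S.mul_mem (hS _) (ih _)) (S.sum_mem fun l _ => ih _)

lemma weyl_perm {B A : Type*} [CommRing B] [CommRing A] [Algebra ℂ A] (n : ℕ)
    (e : Fin n → B →* A) (S : Subalgebra ℂ A) (hS : ∀ b, ∑ i, e i b ∈ S) (c : Fin n → B) :
    ∑ σ : Equiv.Perm (Fin n), ∏ j, e (σ j) (c j) ∈ S := by
  convert weyl_aux n e S hS n c using 1
  rw [← Finset.sum_filter]
  refine Finset.sum_bij (fun σ _ => (σ : Fin n → Fin n)) ?_ ?_ ?_ ?_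
  · intro σ _; simpa using σ.injective
  · intro σ _ τ _ h; exact DFunLike.coe_injective h
  · intro f hf
    have hf' : Function.Injective f := by simpa using hf
    exact ⟨Equiv.ofBijective f (Finite.injective_iff_bijective.1 hf'), Finset.mem_univ _, rfl⟩
  · intro σ _; rfl

end aux

/-- Weyl's theorem: for a commutative ℂ-algebra `B`, the algebra of symmetric tensors
`S^n B = (B^{⊗n})^{S_n}` is generated by the elements
`b ⊗ 1 ⊗ ... ⊗ 1 + 1 ⊗ b ⊗ ... ⊗ 1 + ... + 1 ⊗ 1 ⊗ ... ⊗ b`, `b ∈ B`. -/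
theorem symmetric_tensors_generated_by_power_sums
    (B : Type*) [CommRing B] [Algebra ℂ B] (n : ℕ) (hn : 0 < n)
    (x : ⨂[ℂ] _ : Fin n, B)
    (hx : ∀ σ : Equiv.Perm (Fin n), reindex ℂ (fun _ : Fin n => B) σ x = x) :
    x ∈ Algebra.adjoin ℂ (Set.range fun b : B =>
      ∑ i : Fin n, tprod ℂ (Function.update (fun _ : Fin n => (1 : B)) i b)) := by
  set S := Algebra.adjoin ℂ (Set.range fun b : B =>
      ∑ i : Fin n, tprod ℂ (Function.update (fun _ : Fin n => (1 : B)) i b)) with hSdef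
  let e : Fin n → B →* (⨂[ℂ] _ : Fin n, B) := fun i =>
    (tprodMonoidHom ℂ (A := fun _ : Fin n => B)).comp (MonoidHom.mulSingle (fun _ : Fin n => B) i)
  have he : ∀ i b, e i b = tprod ℂ (Function.update (fun _ : Fin n => (1 : B)) i b) :=
    fun i b => rfl
  have hS : ∀ b, ∑ i, e i b ∈ S := fun b => Algebra.subset_adjoin ⟨b, rfl⟩
  have hsym : ∀ y : ⨂[ℂ] _ : Fin n, B,
      ∑ σ : Equiv.Perm (Fin n), reindex ℂ (fun _ : Fin n => B) σ y ∈ S := by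
    intro y
    induction y using PiTensorProduct.induction_on with
    | smul_tprod r c =>
      simp only [map_smul, ← Finset.smul_sum]
      refine S.smul_mem ?_ r
      convert weyl_perm n e S hS c using 2 with σ
      rw [reindex_tprod]
      simp only [he]
      rw [← tprod_prod]
      congr 1
      ext i
      rw [Finset.prod_apply, Finset.prod_eq_single (σ.symm i)]
      · simp
      · intro j _ hj
        rw [Function.update_of_ne]
        rintro rfl
        simp at hj
      · simp
    | add a b ha hb =>
      simp only [map_add, Finset.sum_add_distrib]
      exact S.add_mem ha hb
  have h := hsym x
  simp only [hx, Finset.sum_const, Finset.card_univ] at h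
  rw [← Nat.cast_smul_eq_nsmul ℂ] at h
  have h3 := S.smul_mem h ((Fintype.card (Equiv.Perm (Fin n)) : ℂ)⁻¹)
  rwa [smul_smul, inv_mul_cancel₀ (Nat.cast_ne_zero.2 Fintype.card_ne_zero), one_smul] at h3
end

section
/- Let W be a finite Coxeter group with set of reflections S and conjugation-invariant c : S → ℂ. Then the rational function Σ_{s ≠ u ∈ S} c_s c_u (α_s, α_u)/(α_s α_u) on h is identically zero. -/
open MvPolynomial Matrix

noncomputable def lin {n : ℕ} (a : Fin n → ℂ) : MvPolynomial (Fin n) ℂ := ∑ j, C (a j) * X j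

lemma lin_add {n : ℕ} (a b : Fin n → ℂ) : lin (a + b) = lin a + lin b := by
  simp [lin, add_mul, Finset.sum_add_distrib]

lemma lin_smul {n : ℕ} (k : ℂ) (a : Fin n → ℂ) : lin (k • a) = C k * lin a := by
  simp [lin, Finset.mul_sum, mul_assoc]

lemma lin_eq_zero {n : ℕ} {a : Fin n → ℂ} (h : lin a = 0) : a = 0 := by
  funext i
  have := congrArg (MvPolynomial.eval (Pi.single i (1:ℂ))) h
  simpa [lin, Pi.single_apply] using this

lemma lin_hom {n : ℕ} (a : Fin n → ℂ) : (lin a).IsHomogeneous 1 := by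
  apply IsHomogeneous.sum
  intro i _
  simpa using (isHomogeneous_C (Fin n) (a i)).mul (isHomogeneous_X ℂ i)

/-- Restriction to the hyperplane orthogonal to `a`. -/
noncomputable def proj {n : ℕ} (a : Fin n → ℂ) :
    MvPolynomial (Fin n) ℂ →ₐ[ℂ] MvPolynomial (Fin n) ℂ :=
  aeval (fun j => X j - C (a j / (a ⬝ᵥ a)) * lin a)

lemma proj_lin {n : ℕ} (a b : Fin n → ℂ) :
    proj a (lin b) = lin b - C ((b ⬝ᵥ a) / (a ⬝ᵥ a)) * lin a := by
  conv_lhs => rw [lin]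
  simp only [proj, map_sum, map_mul, aeval_X, ← algebraMap_eq, AlgHom.commutes]
  simp only [algebraMap_eq, mul_sub, Finset.sum_sub_distrib]
  congr 1
  rw [show b ⬝ᵥ a = ∑ i, b i * a i from rfl, Finset.sum_div, map_sum, Finset.sum_mul]
  refine Finset.sum_congr rfl fun i _ => ?_
  rw [← mul_assoc, ← C_mul, mul_div_assoc]

lemma proj_lin_self {n : ℕ} {a : Fin n → ℂ} (h : a ⬝ᵥ a ≠ 0) : proj a (lin a) = 0 := by
  rw [proj_lin, div_self h]; simp

lemma dvd_sub_proj {n : ℕ} (a : Fin n → ℂ) (p : MvPolynomial (Fin n) ℂ) :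
    lin a ∣ p - proj a p := by
  induction p using MvPolynomial.induction_on with
  | C k => simp [proj]
  | add p q hp hq =>
    rw [map_add]
    have := dvd_add hp hq
    convert this using 1; ring
  | mul_X p i hp =>
    rw [map_mul]
    have : proj a (X i) = X i - C (a i / (a ⬝ᵥ a)) * lin a := by simp [proj]
    rw [this]
    have h2 := dvd_add (hp.mul_right (X i))
      (dvd_mul_left (lin a) (proj a p * C (a i / (a ⬝ᵥ a))))
    convert h2 using 1; ring

lemma dvd_iff {n : ℕ} {a : Fin n → ℂ} (h : a ⬝ᵥ a ≠ 0) (p : MvPolynomial (Fin n) ℂ) :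
    lin a ∣ p ↔ proj a p = 0 := by
  constructor
  · rintro ⟨q, rfl⟩
    rw [map_mul, proj_lin_self h, zero_mul]
  · intro hp
    simpa [hp] using dvd_sub_proj a p

lemma lin_prime {n : ℕ} {a : Fin n → ℂ} (h : a ⬝ᵥ a ≠ 0) : Prime (lin a) := by
  refine ⟨?_, ?_, ?_⟩
  · intro h0
    apply h
    rw [lin_eq_zero h0]; simp
  · intro hu
    have := hu.map (proj a)
    rw [proj_lin_self h] at this
    exact not_isUnit_zero this
  · intro p q hpq
    rw [dvd_iff h, map_mul, mul_eq_zero] at hpq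
    rwa [dvd_iff h, dvd_iff h]

lemma refl_formula {n : ℕ} {M : Matrix (Fin n) (Fin n) ℂ} {a : Fin n → ℂ}
    (ho : Mᵀ * M = 1) (hr : (M - 1).rank = 1) (ha : a ≠ 0) (hM : a ᵥ* M = -a) :
    a ⬝ᵥ a ≠ 0 ∧ ∀ v, v ᵥ* M = v - (2 * (v ⬝ᵥ a) / (a ⬝ᵥ a)) • a := by
  -- rows of M - 1 are multiples of a
  have hspan : ∀ i, ∃ x : ℂ, (M - 1) i = x • a := by
    rw [rank_eq_finrank_span_row] at hr
    have hmem : ∀ v, v ᵥ* (M - 1) ∈ Submodule.span ℂ (Set.range (M - 1).row) := by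
      intro v
      rw [vecMul_eq_sum]
      exact Submodule.sum_mem _ fun i _ =>
        Submodule.smul_mem _ _ (Submodule.subset_span ⟨i, rfl⟩)
    have ha' : a ∈ Submodule.span ℂ (Set.range (M - 1).row) := by
      have h1 := hmem ((-1/2 : ℂ) • a)
      rw [vecMul_sub, smul_vecMul, hM, vecMul_one] at h1
      convert h1 using 1
      ext i; simp; ring
    have := (finrank_eq_one_iff_of_nonzero' (⟨a, ha'⟩ : Submodule.span ℂ (Set.range (M - 1).row))
      (by simpa using ha)).1 hr
    intro i
    obtain ⟨x, hx⟩ := this ⟨(M - 1) i, Submodule.subset_span ⟨i, rfl⟩⟩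
    exact ⟨x, (congrArg Subtype.val hx).symm⟩
  choose x hx using hspan
  have hv : ∀ v, v ᵥ* M = v + (v ⬝ᵥ x) • a := by
    intro v
    have : M = 1 + (M - 1) := by abel
    rw [this, vecMul_add, vecMul_one]
    congr 1
    ext j
    simp only [vecMul, dotProduct, Pi.smul_apply, smul_eq_mul, Finset.sum_mul]
    refine Finset.sum_congr rfl fun i _ => ?_
    rw [hx i]; simp [mul_assoc]
  have hax : a ⬝ᵥ x = -2 := by
    obtain ⟨i, hi⟩ := Function.ne_iff.1 ha
    have h1 := congrFun ((hv a).symm.trans hM) i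
    simp only [Pi.add_apply, Pi.smul_apply, Pi.neg_apply, smul_eq_mul] at h1
    have h2 : (a ⬝ᵥ x + 2) * a i = 0 := by linear_combination h1
    rcases mul_eq_zero.1 h2 with h | h
    · linear_combination h
    · exact absurd h hi
  -- preserve dot product
  have ho' : M * Mᵀ = 1 := mul_eq_one_comm.1 ho
  have hd : ∀ v w, (v ᵥ* M) ⬝ᵥ (w ᵥ* M) = v ⬝ᵥ w := by
    intro v w
    rw [← mulVec_transpose M w, dotProduct_mulVec, vecMul_vecMul, ho', vecMul_one]
  have hva : ∀ v, 2 * (v ⬝ᵥ a) = - (v ⬝ᵥ x) * (a ⬝ᵥ a) := by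
    intro v
    have h1 := hd v a
    rw [hM, hv v] at h1
    simp only [add_dotProduct, smul_dotProduct, dotProduct_neg, smul_eq_mul] at h1
    linear_combination -h1
  have hne : a ⬝ᵥ a ≠ 0 := by
    intro h0
    apply ha
    ext i
    have := hva (Pi.single i 1)
    rw [h0] at this
    simpa using this
  refine ⟨hne, fun v => ?_⟩
  rw [hv, hva v, sub_eq_add_neg, ← neg_smul]
  congr 2
  field_simp


/-- Let `W` be a finite (complexified) Coxeter group of orthogonal transformations of `ℂⁿ`,
`R` its set of reflections, `L s` a root for each reflection `s` (a nonzero linear form with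
`L s ∘ s = -L s`), and `c` a conjugation-invariant parameter. Then
`Σ_{s ≠ u} c_s c_u (α_s, α_u)/(α_s α_u) = 0` as a rational function; equivalently, after
multiplying by `Π_{v ∈ R} α_v`, the polynomial
`Σ_{s ≠ u} c_s c_u (α_s, α_u) Π_{v ≠ s,u} α_v` vanishes. -/
theorem cross_terms_vanish (n : ℕ)
    (W : Subgroup (Matrix.GeneralLinearGroup (Fin n) ℂ)) (hWfin : Finite W)
    (horth : ∀ g ∈ W, (g : Matrix (Fin n) (Fin n) ℂ)ᵀ * (g : Matrix (Fin n) (Fin n) ℂ) = 1)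
    (R : Finset (Matrix.GeneralLinearGroup (Fin n) ℂ))
    (hR : ∀ g, g ∈ R ↔ g ∈ W ∧ ((g : Matrix (Fin n) (Fin n) ℂ) - 1).rank = 1)
    (L : Matrix.GeneralLinearGroup (Fin n) ℂ → Fin n → ℂ)
    (hL : ∀ s ∈ R, L s ≠ 0 ∧
      Matrix.vecMul (L s) (s : Matrix (Fin n) (Fin n) ℂ) = - L s)
    (c : Matrix.GeneralLinearGroup (Fin n) ℂ → ℂ)
    (hc : ∀ g ∈ W, ∀ s ∈ R, g * s * g⁻¹ ∈ R ∧ c (g * s * g⁻¹) = c s) :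
    ∑ s ∈ R, ∑ u ∈ R.erase s,
      (C (c s * c u * ∑ j : Fin n, L s j * L u j)) *
        ∏ v ∈ (R.erase s).erase u, (∑ j : Fin n, C (L v j) * X j) = 0 := by
  have key : ∀ s ∈ R, L s ⬝ᵥ L s ≠ 0 ∧ ∀ v, v ᵥ* (s : Matrix (Fin n) (Fin n) ℂ) =
      v - (2 * (v ⬝ᵥ L s) / (L s ⬝ᵥ L s)) • L s := fun s hs =>
    refl_formula (horth s ((hR s).1 hs).1) ((hR s).1 hs).2 (hL s hs).1 (hL s hs).2
  -- distinct reflections have coprime roots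
  have hnd : ∀ s ∈ R, ∀ u ∈ R, u ≠ s → proj (L s) (lin (L u)) ≠ 0 := by
    intro s hs u hu hus h0
    apply hus
    rw [proj_lin] at h0
    obtain ⟨hs0, hsv⟩ := key s hs
    obtain ⟨hu0, huv⟩ := key u hu
    set k := L u ⬝ᵥ L s / (L s ⬝ᵥ L s) with hk
    have h1 : lin (L u + (-k) • L s) = 0 := by
      rw [lin_add, lin_smul, C_neg]; linear_combination h0
    have h2 : L u = k • L s := by
      have := lin_eq_zero h1
      rw [neg_smul, ← sub_eq_add_neg] at this
      exact sub_eq_zero.1 this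
    have hk0 : k ≠ 0 := by
      intro hk0
      rw [hk0, zero_smul] at h2
      exact (hL u hu).1 h2
    apply Units.ext
    apply Matrix.ext_of_single_vecMul
    intro i
    rw [hsv, huv, h2]
    simp only [dotProduct_smul, smul_dotProduct, smul_eq_mul, smul_smul]
    congr 2
    field_simp
  set F := ∑ s ∈ R, ∑ u ∈ R.erase s,
      (C (c s * c u * ∑ j : Fin n, L s j * L u j)) *
        ∏ v ∈ (R.erase s).erase u, (∑ j : Fin n, C (L v j) * X j) with hF
  set G : GeneralLinearGroup (Fin n) ℂ → GeneralLinearGroup (Fin n) ℂ →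
      MvPolynomial (Fin n) ℂ := fun s u => C (c s * c u * (L s ⬝ᵥ L u)) *
        ∏ v ∈ (R.erase s).erase u, lin (L v) with hG
  have hFG : F = ∑ s ∈ R, ∑ u ∈ R.erase s, G s u := rfl
  have hGsymm : ∀ s u, G s u = G u s := by
    intro s u
    simp only [hG]
    rw [Finset.erase_right_comm, mul_comm (c s), dotProduct_comm]
  have hdvd : ∀ s ∈ R, lin (L s) ∣ F := by
    intro s hs
    obtain ⟨hs0, hsv⟩ := key s hs
    rw [dvd_iff hs0, hFG, ← Finset.add_sum_erase R _ hs, map_add, map_sum, map_sum]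
    have hinner : ∀ t ∈ R.erase s, proj (L s) (∑ u ∈ R.erase t, G t u) = proj (L s) (G s t) := by
      intro t ht
      rw [map_sum, Finset.sum_eq_single s, hGsymm]
      · intro u hu hus
        simp only [hG, map_mul, map_prod]
        rw [Finset.prod_eq_zero (i := s), mul_zero]
        · simp only [Finset.mem_erase] at ht hu ⊢
          exact ⟨hus.symm, ht.1.symm, hs⟩
        · exact proj_lin_self hs0
      · intro h
        exact absurd (Finset.mem_erase.2 ⟨(Finset.ne_of_mem_erase ht).symm, hs⟩) h
    rw [Finset.sum_congr rfl hinner]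
    have hneg : ∑ u ∈ R.erase s, proj (L s) (G s u) =
        ∑ u ∈ R.erase s, - proj (L s) (G s u) := by
      have hsW := ((hR s).1 hs).1
      have hmem : ∀ u ∈ R.erase s, s * u * s⁻¹ ∈ R.erase s := by
        intro u hu
        rw [Finset.mem_erase] at hu ⊢
        refine ⟨fun h => hu.1 ?_, (hc s hsW u hu.2).1⟩
        rw [mul_inv_eq_iff_eq_mul] at h
        exact mul_left_cancel h
      symm
      refine Finset.sum_bij' (fun u _ => s * u * s⁻¹) (fun u _ => s⁻¹ * u * s) hmem ?_ ?_ ?_ ?_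
      · intro u hu
        rw [Finset.mem_erase] at hu ⊢
        refine ⟨fun h => hu.1 ?_, ?_⟩
        · rw [mul_assoc, inv_mul_eq_iff_eq_mul] at h
          exact mul_right_cancel h
        · simpa using (hc s⁻¹ (W.inv_mem hsW) u hu.2).1
      · intro u _; group
      · intro u _; group
      · intro u hu
        have hu' := hmem u hu
        have hcu := (hc s hsW u (Finset.mem_of_mem_erase hu)).2
        set u' := s * u * s⁻¹ with hu'def
        have huR := Finset.mem_of_mem_erase hu
        have huR' := Finset.mem_of_mem_erase hu'
        obtain ⟨hu0, huv⟩ := key u huR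
        -- relation between the roots
        obtain ⟨l, hl⟩ : ∃ l : ℂ, L u' ᵥ* (s : Matrix (Fin n) (Fin n) ℂ) = l • L u := by
          have h1 : (L u' ᵥ* (s : Matrix (Fin n) (Fin n) ℂ)) ᵥ* (u : Matrix (Fin n) (Fin n) ℂ)
              = -(L u' ᵥ* (s : Matrix (Fin n) (Fin n) ℂ)) := by
            have e : u' * s = s * u := by rw [hu'def]; group
            rw [vecMul_vecMul, ← Units.val_mul, ← e, Units.val_mul, ← vecMul_vecMul,
              (hL u' huR').2, neg_vecMul]
          rw [huv] at h1
          set w := L u' ᵥ* (s : Matrix (Fin n) (Fin n) ℂ)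
          refine ⟨w ⬝ᵥ L u / (L u ⬝ᵥ L u), ?_⟩
          ext i
          have := congrFun h1 i
          simp only [Pi.sub_apply, Pi.smul_apply, Pi.neg_apply, smul_eq_mul] at this ⊢
          linear_combination this / 2
        have hdot : L s ⬝ᵥ L u' = - (l * (L s ⬝ᵥ L u)) := by
          have h1 := congrArg (fun v => L s ⬝ᵥ v) hl
          simp only [hsv, dotProduct_sub, dotProduct_smul, smul_eq_mul] at h1
          rw [div_mul_cancel₀ _ hs0, dotProduct_comm (L u')] at h1
          linear_combination -h1
        have hproj : proj (L s) (lin (L u')) = C l * proj (L s) (lin (L u)) := by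
          have h1 : L u' = l • L u + (2 * (L u' ⬝ᵥ L s) / (L s ⬝ᵥ L s)) • L s := by
            rw [← hl, hsv]; abel
          rw [h1, lin_add, lin_smul, lin_smul, map_add, map_mul, map_mul, proj_lin_self hs0]
          simp [proj]
        have hprod : C l * proj (L s) (∏ v ∈ (R.erase s).erase u', lin (L v)) =
            proj (L s) (∏ v ∈ (R.erase s).erase u, lin (L v)) := by
          apply mul_left_cancel₀ (hnd s hs u huR (Finset.ne_of_mem_erase hu))
          rw [← map_mul, Finset.mul_prod_erase _ (fun v => lin (L v)) hu,
            ← Finset.mul_prod_erase _ (fun v => lin (L v)) hu', map_mul, hproj]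
          ring
        have hCC : ∀ z : ℂ, proj (L s) (C z) = C z := fun z => by simp [proj]
        simp only [hG, map_mul (proj (L s)), hCC]
        rw [← hprod, hdot, hcu]
        simp only [C_mul, C_neg]
        ring
    rw [Finset.sum_neg_distrib] at hneg
    linear_combination hneg
  have hP : (∏ v ∈ R, lin (L v)) ∣ F := by
    apply Finset.prod_dvd_of_isRelPrime
    · intro s hs u hu hsu
      have hs' : s ∈ R := by simpa using hs
      have hu' : u ∈ R := by simpa using hu
      show IsRelPrime _ _
      rw [(lin_prime (key s hs').1).irreducible.isRelPrime_iff_not_dvd, dvd_iff (key s hs').1]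
      exact hnd s hs' u hu' hsu.symm
    · exact hdvd
  by_contra hF0
  have hle := totalDegree_le_of_dvd_of_isDomain hP hF0
  have hPd : (∏ v ∈ R, lin (L v)).totalDegree = R.card := by
    have h1 : (∏ v ∈ R, lin (L v)).IsHomogeneous (∑ v ∈ R, 1) :=
      IsHomogeneous.prod _ _ _ fun v _ => lin_hom _
    rw [h1.totalDegree, Finset.card_eq_sum_ones]
    exact Finset.prod_ne_zero_iff.2 fun v hv => (lin_prime (key v hv).1).ne_zero
  have hFd : F.IsHomogeneous (R.card - 2) := by
    rw [hFG]
    refine IsHomogeneous.sum _ _ _ fun s hs => IsHomogeneous.sum _ _ _ fun u hu => ?_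
    have h1 : (∏ v ∈ (R.erase s).erase u, lin (L v)).IsHomogeneous
        (∑ v ∈ (R.erase s).erase u, 1) :=
      IsHomogeneous.prod _ _ _ fun v _ => lin_hom _
    rw [← Finset.card_eq_sum_ones, Finset.card_erase_of_mem hu, Finset.card_erase_of_mem hs] at h1
    have h2 := (isHomogeneous_C (Fin n) (c s * c u * (L s ⬝ᵥ L u))).mul h1
    rw [zero_add, Nat.sub_sub] at h2
    exact h2
  rw [hPd, hFd.totalDegree hF0] at hle
  have hR0 : R.card = 0 := by omega
  apply hF0
  rw [hFG, Finset.card_eq_zero.1 hR0, Finset.sum_empty]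
end

section
/- In the rank-one rational Cherednik algebra H_{t,k}, generated by x, y, s with relations s² = 1, sx = −xs, sy = −ys, [y,x] = t − 2ks, the elements s x^a y^b (a,b ≥ 0, together with x^a y^b) form a basis: H_{t,k} is a free module with basis {x^a y^b, s x^a y^b : a, b ∈ ℤ_{≥0}}. -/
noncomputable section

/-- Generators of the rank-one rational Cherednik algebra: `x`, `y`, `s`. -/
def rx : FreeAlgebra ℂ (Fin 3) := FreeAlgebra.ι ℂ 0
def ry : FreeAlgebra ℂ (Fin 3) := FreeAlgebra.ι ℂ 1
def rs : FreeAlgebra ℂ (Fin 3) := FreeAlgebra.ι ℂ 2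

/-- The defining relations of the rank-one rational Cherednik algebra `H_{t,k}`:
`s² = 1`, `sx = -xs`, `sy = -ys`, `[y,x] = t - 2ks`. -/
inductive CherednikRel (t k : ℂ) : FreeAlgebra ℂ (Fin 3) → FreeAlgebra ℂ (Fin 3) → Prop
  | ss : CherednikRel t k (rs * rs) 1
  | sx : CherednikRel t k (rs * rx) (-(rx * rs))
  | sy : CherednikRel t k (rs * ry) (-(ry * rs))
  | yx : CherednikRel t k (ry * rx) (rx * ry + algebraMap ℂ _ t - algebraMap ℂ _ (2 * k) * rs)

/-- The rank-one rational Cherednik algebra `H_{t,k}`. -/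
abbrev CherednikRank1 (t k : ℂ) := RingQuot (CherednikRel t k)

namespace PBWAux

abbrev V := (Bool × ℕ × ℕ) →₀ ℂ

def sg (e : Bool) : ℂ := if e then -1 else 1

def c : ℕ → ℂ
  | 0 => 0
  | n + 1 => 1 - c n

def bv (e : Bool) (a b : ℕ) : V := Finsupp.single (e, a, b) 1

def opS : Module.End ℂ V := Finsupp.linearCombination ℂ (fun p => bv (!p.1) p.2.1 p.2.2)

def opX : Module.End ℂ V :=
  Finsupp.linearCombination ℂ (fun p => sg p.1 • bv p.1 (p.2.1 + 1) p.2.2)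

def opY (t k : ℂ) : Module.End ℂ V :=
  Finsupp.linearCombination ℂ (fun p => sg p.1 • (bv p.1 p.2.1 (p.2.2 + 1)
    + (t * p.2.1) • bv p.1 (p.2.1 - 1) p.2.2
    - (2 * k * c p.2.1) • bv (!p.1) (p.2.1 - 1) p.2.2))

lemma opS_bv (e a b) : opS (bv e a b) = bv (!e) a b := by
  simp [opS, bv]

lemma opX_bv (e a b) : opX (bv e a b) = sg e • bv e (a + 1) b := by
  simp [opX, bv]

lemma opY_bv (t k : ℂ) (e a b) : opY t k (bv e a b) = sg e • (bv e a (b + 1)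
    + (t * a) • bv e (a - 1) b - (2 * k * c a) • bv (!e) (a - 1) b) := by
  rw [opY, bv, Finsupp.linearCombination_single, one_smul]

lemma hom_ext {M : Type*} [AddCommMonoid M] [Module ℂ M] {f g : V →ₗ[ℂ] M}
    (h : ∀ e a b, f (bv e a b) = g (bv e a b)) : f = g := by
  apply Finsupp.lhom_ext'
  rintro ⟨e, a, b⟩
  apply LinearMap.ext_ring
  exact h e a b

lemma sg_not (e : Bool) : sg (!e) = - sg e := by cases e <;> simp [sg]

lemma sg_sq (e : Bool) : sg e * sg e = 1 := by cases e <;> simp [sg]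

lemma rel_ss : opS * opS = 1 := by
  apply hom_ext
  intro e a b
  simp [opS_bv]

lemma rel_sx : opS * opX = -(opX * opS) := by
  apply hom_ext
  intro e a b
  simp [opS_bv, opX_bv, sg_not]

lemma rel_sy (t k : ℂ) : opS * opY t k = -(opY t k * opS) := by
  apply hom_ext
  intro e a b
  simp [opS_bv, opY_bv, sg_not]

lemma rel_yx (t k : ℂ) : opY t k * opX = opX * opY t k + algebraMap ℂ _ t
    - algebraMap ℂ _ (2 * k) * opS := by
  apply hom_ext
  intro e a b
  rcases a with _ | a <;> cases e <;>
  simp [opS_bv, opX_bv, opY_bv, sg, c, Module.algebraMap_end_apply] <;> module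

def gen (t k : ℂ) : Fin 3 → Module.End ℂ V := ![opX, opY t k, opS]

def rep (t k : ℂ) : RingQuot (CherednikRel t k) →ₐ[ℂ] Module.End ℂ V :=
  RingQuot.liftAlgHom ℂ ⟨FreeAlgebra.lift ℂ (gen t k), by
    intro a b h
    cases h with
    | ss => simpa [rs, gen] using rel_ss
    | sx => simpa [rs, rx, gen] using rel_sx
    | sy => simpa [rs, ry, gen] using rel_sy t k
    | yx => simpa [rs, rx, ry, gen] using rel_yx t k⟩

lemma rep_mk (t k : ℂ) (z) : rep t k (RingQuot.mkAlgHom ℂ (CherednikRel t k) z)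
    = FreeAlgebra.lift ℂ (gen t k) z := by
  simp [rep]

lemma opY_pow (t k : ℂ) (b : ℕ) : (opY t k ^ b) (bv false 0 0) = bv false 0 b := by
  induction b with
  | zero => simp
  | succ n ih => rw [pow_succ', Module.End.mul_apply, ih, opY_bv]; simp [sg, c]

lemma opX_pow (a b : ℕ) : (opX ^ a) (bv false 0 b) = bv false a b := by
  induction a with
  | zero => simp
  | succ n ih => rw [pow_succ', Module.End.mul_apply, ih, opX_bv]; simp [sg]

lemma rep_mon (t k : ℂ) (p : Bool × ℕ × ℕ) :
    rep t k (RingQuot.mkAlgHom ℂ (CherednikRel t k)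
        ((if p.1 then rs else 1) * rx ^ p.2.1 * ry ^ p.2.2)) (bv false 0 0)
      = Finsupp.single p 1 := by
  obtain ⟨e, a, b⟩ := p
  rw [rep_mk]
  have hx : FreeAlgebra.lift ℂ (gen t k) rx = opX := by simp [rx, gen]
  have hy : FreeAlgebra.lift ℂ (gen t k) ry = opY t k := by simp [ry, gen]
  have hs : FreeAlgebra.lift ℂ (gen t k) rs = opS := by simp [rs, gen]
  rw [map_mul, map_mul, map_pow, map_pow, hx, hy, Module.End.mul_apply, Module.End.mul_apply,
    opY_pow, opX_pow]
  cases e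
  · simp [bv]
  · simp only [if_true, hs, opS_bv]; simp [bv]

section span

variable {A : Type*} [Ring A] [Algebra ℂ A] (t k : ℂ) (x y s : A)

def phi : V →ₗ[ℂ] A :=
  Finsupp.linearCombination ℂ (fun p => (if p.1 then s else 1) * x ^ p.2.1 * y ^ p.2.2)

lemma phi_bv (e a b) : phi x y s (bv e a b) = (if e then s else 1) * x ^ a * y ^ b := by
  simp [phi, bv]

variable {t k x y s}

lemma phi_S (hss : s * s = 1) (v : V) : phi x y s (opS v) = s * phi x y s v := by
  have : phi x y s ∘ₗ opS = LinearMap.mulLeft ℂ s ∘ₗ phi x y s := by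
    apply hom_ext
    intro e a b
    cases e <;> simp [opS_bv, phi_bv, ← mul_assoc, hss]
  exact LinearMap.congr_fun this v

lemma phi_X (hsx : s * x = -(x * s)) (v : V) : phi x y s (opX v) = x * phi x y s v := by
  have : phi x y s ∘ₗ opX = LinearMap.mulLeft ℂ x ∘ₗ phi x y s := by
    apply hom_ext
    intro e a b
    have hxs : x * s = -(s * x) := by rw [hsx, neg_neg]
    cases e <;> simp [opX_bv, phi_bv, sg, ← mul_assoc, hxs, pow_succ']
  exact LinearMap.congr_fun this v

lemma comm_pow (hsx : s * x = -(x * s))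
    (hyx : y * x = x * y + algebraMap ℂ A t - algebraMap ℂ A (2 * k) * s) (a : ℕ) :
    y * x ^ a = x ^ a * y + (t * a) • x ^ (a - 1) - (2 * k * c a) • (s * x ^ (a - 1)) := by
  have hxs : x * s = -(s * x) := by rw [hsx, neg_neg]
  induction a with
  | zero => simp [c]
  | succ n ih =>
    have h1 : y * x ^ (n + 1) = x * (y * x ^ n) + t • x ^ n - (2 * k) • (s * x ^ n) := by
      rw [pow_succ', ← mul_assoc, hyx]
      simp only [Algebra.algebraMap_eq_smul_one, sub_mul, add_mul, smul_mul_assoc, one_mul,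
        mul_assoc]
    rw [h1, ih]
    rcases n with _ | n
    · simp [c]
    · have h2 : x * (s * x ^ n) = -(s * x ^ (n + 1)) := by
        rw [← mul_assoc, hxs, pow_succ', neg_mul, mul_assoc]
      simp only [mul_sub, mul_add, mul_smul_comm, Nat.add_sub_cancel, h2, ← mul_assoc, ← pow_succ']
      simp only [c]
      push_cast
      module

lemma phi_Y (hss : s * s = 1) (hsx : s * x = -(x * s)) (hsy : s * y = -(y * s))
    (hyx : y * x = x * y + algebraMap ℂ A t - algebraMap ℂ A (2 * k) * s) (v : V) :
    phi x y s (opY t k v) = y * phi x y s v := by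
  have : phi x y s ∘ₗ opY t k = LinearMap.mulLeft ℂ y ∘ₗ phi x y s := by
    apply hom_ext
    intro e a b
    have hys : y * s = -(s * y) := by rw [hsy, neg_neg]
    have hc := comm_pow hsx hyx a
    have key : y * (x ^ a * y ^ b) = x ^ a * y ^ (b + 1) + (t * a) • (x ^ (a - 1) * y ^ b)
        - (2 * k * c a) • (s * (x ^ (a - 1) * y ^ b)) := by
      rw [← mul_assoc, hc, pow_succ']
      simp only [sub_mul, add_mul, smul_mul_assoc, mul_assoc]
    cases e
    · simp only [LinearMap.comp_apply, LinearMap.mulLeft_apply, opY_bv, phi_bv, map_smul, map_add,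
        map_sub, sg]
      simp [key, mul_assoc]
    · have key2 : y * (s * (x ^ a * y ^ b)) = -(s * (y * (x ^ a * y ^ b))) := by
        rw [← mul_assoc, hys, neg_mul, mul_assoc]
      have hss' : ∀ z, s * (s * z) = z := fun z => by rw [← mul_assoc, hss, one_mul]
      simp only [LinearMap.comp_apply, LinearMap.mulLeft_apply, opY_bv, phi_bv, map_smul, map_add,
        map_sub, sg]
      simp [key2, key, mul_assoc, mul_add, mul_sub, hss']
      try abel
  exact LinearMap.congr_fun this v

end span

end PBWAux

open PBWAux

/-- PBW theorem in rank one: the elements `x^a y^b` and `s x^a y^b` (`a, b ∈ ℕ`) form a basis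
of `H_{t,k}`: they are linearly independent and span `H_{t,k}` over `ℂ`. -/
theorem cherednik_rank1_pbw (t k : ℂ) :
    LinearIndependent ℂ (fun p : Bool × ℕ × ℕ =>
      RingQuot.mkAlgHom ℂ (CherednikRel t k)
        ((if p.1 then rs else 1) * rx ^ p.2.1 * ry ^ p.2.2)) ∧
    Submodule.span ℂ (Set.range (fun p : Bool × ℕ × ℕ =>
      RingQuot.mkAlgHom ℂ (CherednikRel t k)
        ((if p.1 then rs else 1) * rx ^ p.2.1 * ry ^ p.2.2))) = ⊤ := by
  constructor
  · have h : LinearIndependent ℂ (fun p : Bool × ℕ × ℕ => (Finsupp.single p 1 : V)) := by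
      simpa using (Finsupp.basisSingleOne (R := ℂ) (ι := Bool × ℕ × ℕ)).linearIndependent
    apply LinearIndependent.of_comp
      ((LinearMap.applyₗ (bv false 0 0)) ∘ₗ (rep t k).toLinearMap)
    rw [← funext (rep_mon t k)] at h
    exact h
  · set π := RingQuot.mkAlgHom ℂ (CherednikRel t k) with hπ
    have hss : π rs * π rs = 1 := by
      rw [← map_mul, hπ, RingQuot.mkAlgHom_rel ℂ CherednikRel.ss, map_one]
    have hsx : π rs * π rx = -(π rx * π rs) := by
      rw [← map_mul, hπ, RingQuot.mkAlgHom_rel ℂ CherednikRel.sx, map_neg, map_mul]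
    have hsy : π rs * π ry = -(π ry * π rs) := by
      rw [← map_mul, hπ, RingQuot.mkAlgHom_rel ℂ CherednikRel.sy, map_neg, map_mul]
    have hyx : π ry * π rx = π rx * π ry + algebraMap ℂ _ t - algebraMap ℂ _ (2 * k) * π rs := by
      rw [← map_mul, hπ, RingQuot.mkAlgHom_rel ℂ CherednikRel.yx, map_sub, map_add, map_mul,
        map_mul, AlgHom.commutes, AlgHom.commutes]
    have hr : (fun p : Bool × ℕ × ℕ => π ((if p.1 then rs else 1) * rx ^ p.2.1 * ry ^ p.2.2))
        = fun p => (if p.1 then π rs else 1) * π rx ^ p.2.1 * π ry ^ p.2.2 := by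
      funext p
      rw [map_mul, map_mul, map_pow, map_pow, apply_ite π, map_one]
    rw [hr, ← Finsupp.range_linearCombination]
    change LinearMap.range (phi (π rx) (π ry) (π rs)) = ⊤
    have main : ∀ z : FreeAlgebra ℂ (Fin 3), ∀ v : V, ∃ w : V,
        phi (π rx) (π ry) (π rs) w = π z * phi (π rx) (π ry) (π rs) v := by
      intro z
      induction z using FreeAlgebra.induction with
      | grade0 r =>
        intro v
        exact ⟨r • v, by rw [map_smul, AlgHom.commutes, Algebra.smul_def]⟩
      | grade1 i =>
        intro v
        fin_cases i
        · exact ⟨_, phi_X hsx v⟩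
        · exact ⟨_, phi_Y hss hsx hsy hyx v⟩
        · exact ⟨_, phi_S hss v⟩
      | mul a b ha hb =>
        intro v
        obtain ⟨w, hw⟩ := hb v
        obtain ⟨u, hu⟩ := ha w
        exact ⟨u, by rw [hu, hw, map_mul, mul_assoc]⟩
      | add a b ha hb =>
        intro v
        obtain ⟨w, hw⟩ := hb v
        obtain ⟨u, hu⟩ := ha v
        exact ⟨u + w, by rw [map_add, hu, hw, map_add, add_mul]⟩
    rw [LinearMap.range_eq_top]
    intro h
    obtain ⟨z, rfl⟩ := RingQuot.mkAlgHom_surjective ℂ (CherednikRel t k) h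
    obtain ⟨w, hw⟩ := main z (bv false 0 0)
    exact ⟨w, by rw [hw, phi_bv]; simp [hπ]⟩

end
end
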